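/- arXiv:1708.06002 — 6 statements merged into one kernel-verified Lean document; each statement's English description precedes it below -/
import Mathlib

section
/- Let ϱ be a density matrix on ℂ^D and let Φ : Matrix (Fin D) (Fin D) ℂ → Matrix (Fin D) (Fin D) ℂ be a linear map that is positive (Φ maps positive semidefinite matrices to positive semidefinite matrices), unital (Φ(I) = I), and satisfies tr(ϱ·Φ(X)) = tr(ϱ·X) for every matrix X. Then for every Hermitian matrix O, the variance does not increase under Φ: Re(tr(ϱ·Φ(O)²)) − (Re(tr(ϱ·Φ(O))))² ≤ Re(tr(ϱ·O²)) − (Re(tr(ϱ·O)))². -/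
open Matrix
open scoped ComplexOrder

/-- A Hermitian matrix and its square are combinations, with real coefficients `d i` and `d i ^ 2`,
of positive semidefinite matrices summing to the identity. -/
theorem Matrix.IsHermitian.exists_posSemidef_resolution {n : Type*} [Fintype n] [DecidableEq n]
    {A : Matrix n n ℂ} (hA : A.IsHermitian) :
    ∃ (d : n → ℝ) (P : n → Matrix n n ℂ), (∀ i, (P i).PosSemidef) ∧ ∑ i, P i = 1 ∧
      A = ∑ i, (d i : ℂ) • P i ∧ A ^ 2 = ∑ i, ((d i : ℂ) ^ 2) • P i := by
  set U : Matrix n n ℂ := (hA.eigenvectorUnitary : Matrix n n ℂ)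
  have hUU : U * star U = 1 := Unitary.coe_mul_star_self hA.eigenvectorUnitary
  have hUU' : star U * U = 1 := Unitary.coe_star_mul_self hA.eigenvectorUnitary
  have hsum (c : n → ℂ) :
      ∑ i, c i • (U * diagonal (Pi.single i 1) * star U) = U * diagonal c * star U := by
    have hc : diagonal c = ∑ i, c i • diagonal (Pi.single i (1 : ℂ)) := by
      ext j k
      simp [Matrix.sum_apply, diagonal_apply, Pi.single_apply]
    simp [hc, Finset.mul_sum, Finset.sum_mul]
  have hspec : A = U * diagonal (fun i => (hA.eigenvalues i : ℂ)) * star U :=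
    hA.spectral_theorem
  refine ⟨hA.eigenvalues, fun i => U * diagonal (Pi.single i 1) * star U, fun i => ?_, ?_, ?_, ?_⟩
  · refine PosSemidef.mul_mul_conjTranspose_same (PosSemidef.diagonal ?_) U
    exact Pi.single_nonneg.2 zero_le_one
  · simpa [hUU] using hsum 1
  · rw [hsum, ← hspec]
  · rw [hsum]
    calc A ^ 2 = U * diagonal (fun i => (hA.eigenvalues i : ℂ)) * (star U * U) *
          diagonal (fun i => (hA.eigenvalues i : ℂ)) * star U := by
          nth_rewrite 1 [hspec]
          noncomm_ring
      _ = _ := by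
          rw [hUU', mul_one, mul_assoc U, diagonal_mul_diagonal]
          simp only [sq]

/-- **Kadison's inequality** for positive unital maps between matrix algebras. -/
theorem Matrix.posSemidef_map_sq_sub_sq_map {m n : Type*} [Fintype m] [DecidableEq m]
    [Fintype n] [DecidableEq n] (Φ : Matrix m m ℂ →ₗ[ℂ] Matrix n n ℂ)
    (hpos : ∀ X : Matrix m m ℂ, X.PosSemidef → (Φ X).PosSemidef) (hunital : Φ 1 = 1)
    {A : Matrix m m ℂ} (hA : A.IsHermitian) : (Φ (A ^ 2) - Φ A ^ 2).PosSemidef := by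
  obtain ⟨d, P, hP, hP1, hAP, hA2P⟩ := hA.exists_posSemidef_resolution
  have hQ1 : ∑ i, Φ (P i) = 1 := by rw [← map_sum, hP1, hunital]
  have hB : Φ A = ∑ i, (d i : ℂ) • Φ (P i) := by rw [hAP]; simp
  have hB2 : Φ (A ^ 2) = ∑ i, ((d i : ℂ) ^ 2) • Φ (P i) := by rw [hA2P]; simp
  set B := Φ A
  have hBherm : Bᴴ = B := by
    rw [hB, conjTranspose_sum]
    simp [conjTranspose_smul, fun i => (hpos _ (hP i)).isHermitian.eq]
  have key : Φ (A ^ 2) - B ^ 2 =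
      ∑ i, ((d i : ℂ) • 1 - B) * Φ (P i) * ((d i : ℂ) • 1 - B)ᴴ := by
    have hterm (i : m) : ((d i : ℂ) • 1 - B) * Φ (P i) * ((d i : ℂ) • 1 - B)ᴴ =
        ((d i : ℂ) ^ 2) • Φ (P i) - ((d i : ℂ) • Φ (P i)) * B - B * ((d i : ℂ) • Φ (P i))
          + B * Φ (P i) * B := by
      simp only [conjTranspose_sub, conjTranspose_smul, conjTranspose_one, hBherm, sub_mul,
        mul_sub, smul_mul_assoc, mul_smul_comm, one_mul, mul_one, RCLike.star_def,
        Complex.conj_ofReal, sq, mul_smul, smul_sub]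
      abel
    simp only [hterm, Finset.sum_add_distrib, Finset.sum_sub_distrib, ← Finset.sum_mul,
      ← Finset.mul_sum, hQ1, ← hB, ← hB2]
    noncomm_ring
  rw [key]
  exact posSemidef_sum _ fun i _ => (hpos _ (hP i)).mul_mul_conjTranspose_same _

open scoped MatrixOrder in
theorem Matrix.PosSemidef.trace_mul_nonneg {n : Type*} [Fintype n] [DecidableEq n]
    {A B : Matrix n n ℂ} (hA : A.PosSemidef) (hB : B.PosSemidef) : 0 ≤ (A * B).trace := by
  obtain ⟨C, rfl⟩ := CStarAlgebra.nonneg_iff_eq_star_mul_self.mp hA.nonneg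
  rw [mul_assoc, trace_mul_comm, star_eq_conjTranspose]
  exact (hB.mul_mul_conjTranspose_same C).trace_nonneg

theorem stmt1 (D : ℕ) (ϱ : Matrix (Fin D) (Fin D) ℂ)
    (hϱ : ϱ.PosSemidef) (hϱtr : ϱ.trace = 1)
    (Φ : Matrix (Fin D) (Fin D) ℂ →ₗ[ℂ] Matrix (Fin D) (Fin D) ℂ)
    (hpos : ∀ X : Matrix (Fin D) (Fin D) ℂ, X.PosSemidef → (Φ X).PosSemidef)
    (hunital : Φ 1 = 1)
    (hmean : ∀ X : Matrix (Fin D) (Fin D) ℂ, (ϱ * Φ X).trace = (ϱ * X).trace)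
    (O : Matrix (Fin D) (Fin D) ℂ) (hO : O.IsHermitian) :
    ((ϱ * (Φ O) ^ 2).trace).re - (((ϱ * Φ O).trace).re) ^ 2 ≤
      ((ϱ * O ^ 2).trace).re - (((ϱ * O).trace).re) ^ 2 := by
  have h := hϱ.trace_mul_nonneg (posSemidef_map_sq_sub_sq_map Φ hpos hunital hO)
  rw [mul_sub, trace_sub, hmean, sub_nonneg] at h
  rw [hmean]
  exact sub_le_sub_right (Complex.le_def.1 h).1 _
end

section
/- Let ρ₁, …, ρ_n be d×d complex matrices and let π be the cyclic permutation of Fin n given by π(i) = i+1 (mod n). Then tr((ρ₁ ⊗ ⋯ ⊗ ρ_n) · P(π⁻¹)) = tr(ρ₁·ρ₂·⋯·ρ_n), where ρ₁ ⊗ ⋯ ⊗ ρ_n is the matrix indexed by x, y : Fin n → Fin d with entry ∏_{i} (ρ_i)[x i, y i]. -/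
open Matrix

/-- The permutation operator `P(π)` on `(ℂ^d)^{⊗n}`, as a matrix indexed by
functions `Fin n → Fin d`: its `(x, y)` entry is `1` if `y = x ∘ π` and `0` otherwise. -/
noncomputable def permOp (n d : ℕ) (π : Equiv.Perm (Fin n)) :
    Matrix (Fin n → Fin d) (Fin n → Fin d) ℂ :=
  Matrix.of fun x y => if y = x ∘ ⇑π then 1 else 0

/-- The tensor product `ρ₁ ⊗ ⋯ ⊗ ρ_n` as a matrix indexed by `Fin n → Fin d`. -/
noncomputable def tensorFam (n d : ℕ) (ρ : Fin n → Matrix (Fin d) (Fin d) ℂ) :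
    Matrix (Fin n → Fin d) (Fin n → Fin d) ℂ :=
  Matrix.of fun x y => ∏ i, ρ i (x i) (y i)

/-- An entry of a product of matrices is a sum over the intermediate indices. -/
theorem Matrix.prod_ofFn_succ_apply {R m : Type*} [CommSemiring R] [Fintype m] [DecidableEq m]
    (n : ℕ) (ρ : Fin (n + 1) → Matrix m m R) (a b : m) :
    (List.ofFn ρ).prod a b =
      ∑ x : Fin n → m, ∏ i, ρ i ((Fin.cons a x : Fin (n + 1) → m) i)
        ((Fin.snoc x b : Fin (n + 1) → m) i) := by
  induction n generalizing a with
  | zero => simp [Fin.snoc]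
  | succ n ih =>
    rw [List.ofFn_succ, List.prod_cons, Matrix.mul_apply,
      ← (Fin.consEquiv fun _ : Fin (n + 1) => m).sum_comp, Fintype.sum_prod_type]
    refine Finset.sum_congr rfl fun c _ => ?_
    rw [ih, Finset.mul_sum]
    refine Finset.sum_congr rfl fun x _ => ?_
    rw [Fin.prod_univ_succ (n := n + 1)]
    simp [Fin.consEquiv, ← Fin.cons_snoc_eq_snoc_cons]

/-- The trace of a product of matrices is a sum over cyclic sequences of indices. -/
theorem Matrix.trace_prod_ofFn_succ {R m : Type*} [CommSemiring R] [Fintype m] [DecidableEq m]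
    (n : ℕ) (ρ : Fin (n + 1) → Matrix m m R) :
    (List.ofFn ρ).prod.trace =
      ∑ x : Fin (n + 1) → m, ∏ i, ρ i (x i) (x (finRotate (n + 1) i)) := by
  rw [← (Fin.consEquiv fun _ : Fin (n + 1) => m).sum_comp, Fintype.sum_prod_type]
  simp only [Matrix.trace, Matrix.diag_apply, Matrix.prod_ofFn_succ_apply,
    Fin.snoc_eq_cons_rotate, Fin.consEquiv, Equiv.coe_fn_mk]

theorem trace_tensorFam_mul_permOp_inv (n d : ℕ) (ρ : Fin n → Matrix (Fin d) (Fin d) ℂ)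
    (π : Equiv.Perm (Fin n)) :
    (tensorFam n d ρ * permOp n d π⁻¹).trace =
      ∑ x : Fin n → Fin d, ∏ i, ρ i (x i) (x (π i)) := by
  have key (x y : Fin n → Fin d) : x = y ∘ ⇑π⁻¹ ↔ y = x ∘ ⇑π := by
    constructor <;> rintro rfl <;> ext i <;> simp
  simp [Matrix.trace, Matrix.mul_apply, tensorFam, permOp, -Equiv.Perm.coe_inv, key]

theorem stmt3 (n d : ℕ) (hn : 0 < n) (hd : 0 < d)
    (ρ : Fin n → Matrix (Fin d) (Fin d) ℂ) :
    (tensorFam n d ρ * permOp n d (finRotate n)⁻¹).trace = (List.ofFn ρ).prod.trace := by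
  obtain ⟨n, rfl⟩ := Nat.exists_eq_add_one_of_ne_zero hn.ne'
  rw [trace_tensorFam_mul_permOp_inv, Matrix.trace_prod_ofFn_succ]
end

section
/- Let ρ be a d×d complex matrix with tr(ρ) = 1, let n be a positive integer, and let π be any permutation of Fin n. Then tr(ρ^{⊗n} · P(π)) = ∏_{k ∈ cycleType(π)} tr(ρ^k), where cycleType(π) is the multiset of lengths (≥ 2) of the nontrivial cycles of π, ρ^{⊗n} is the matrix indexed by x, y : Fin n → Fin d with entry ∏_i ρ[x i, y i], and the product is over the multiset cycleType(π). -/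
open Matrix

/-- The tensor power `ρ^{⊗n}` as a matrix indexed by `Fin n → Fin d`. -/
noncomputable def tensorPow (n d : ℕ) (ρ : Matrix (Fin d) (Fin d) ℂ) :
    Matrix (Fin n → Fin d) (Fin n → Fin d) ℂ :=
  Matrix.of fun x y => ∏ i, ρ (x i) (y i)

/-- The index form of `tr(M^{⊗α} P(π))`: the sum over all colourings `x` of `α` of
`∏ i, M (x (π i)) (x i)`. -/
def permSum {α ι R : Type*} [Fintype α] [DecidableEq α] [Fintype ι] [CommSemiring R]
    (M : Matrix ι ι R) (π : Equiv.Perm α) : R :=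
  ∑ x : α → ι, ∏ i, M (x (π i)) (x i)

section permSum

variable {α β ι R : Type*} [Fintype α] [DecidableEq α] [Fintype β] [DecidableEq β]
  [Fintype ι] [CommSemiring R] (M : Matrix ι ι R)

theorem permSum_congr (e : α ≃ β) (π : Equiv.Perm α) (τ : Equiv.Perm β)
    (h : ∀ i, τ (e i) = e (π i)) : permSum M π = permSum M τ := by
  refine (Fintype.sum_equiv (e.arrowCongr (Equiv.refl ι)).symm _ _ fun x => ?_).symm
  refine (Fintype.prod_equiv e _ _ fun i => ?_).symm
  simp [h]

theorem permSum_eq_of_isConj {σ τ : Equiv.Perm α} (h : IsConj σ τ) :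
    permSum M σ = permSum M τ := by
  obtain ⟨c, rfl⟩ := isConj_iff.1 h
  exact permSum_congr M c _ _ fun i => by simp

theorem permSum_one (hM : M.trace = 1) : permSum M (1 : Equiv.Perm α) = 1 := by
  classical
  have h := Fintype.prod_sum fun (_ : α) (j : ι) => M j j
  have ht : ∑ j, M j j = 1 := hM
  simpa [permSum, ht] using h.symm

theorem permSum_eq_mul_subtypePerm (p : α → Prop) [DecidablePred p] (π : Equiv.Perm α)
    (h : ∀ i, p (π i) ↔ p i) :
    permSum M π = permSum M (π.subtypePerm h) *
      permSum M (π.subtypePerm (p := fun i => ¬ p i) fun i => not_congr (h i)) := by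
  simp only [permSum]
  rw [Finset.sum_mul_sum, ← Fintype.sum_prod_type']
  refine Fintype.sum_equiv (Equiv.piEquivPiSubtypeProd p fun _ => ι) _ _ fun x => ?_
  rw [← Fintype.prod_subtype_mul_prod_subtype p]
  rfl

theorem permSum_mul_of_disjoint (hM : M.trace = 1) {σ τ : Equiv.Perm α} (h : σ.Disjoint τ) :
    permSum M (σ * τ) = permSum M σ * permSum M τ := by
  have hσ : ∀ i, σ (σ i) ≠ σ i ↔ σ i ≠ i := fun i => σ.injective.ne_iff
  have hτ : ∀ i, σ (τ i) ≠ τ i ↔ σ i ≠ i := fun i => by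
    have := h (τ i)
    have := h i
    have := τ.injective.eq_iff (a := τ i) (b := i)
    grind
  have hστ : ∀ i, σ ((σ * τ) i) ≠ (σ * τ) i ↔ σ i ≠ i := fun i => (hσ _).trans (hτ i)
  rw [permSum_eq_mul_subtypePerm M (fun i => σ i ≠ i) _ hστ,
    permSum_eq_mul_subtypePerm M (fun i => σ i ≠ i) _ hσ,
    permSum_eq_mul_subtypePerm M (fun i => σ i ≠ i) _ hτ]
  have h₁ : σ.subtypePerm (p := fun i => ¬ σ i ≠ i) (fun i => not_congr (hσ i)) = 1 := by
    ext i
    simpa using i.2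
  have h₂ : τ.subtypePerm (p := fun i => σ i ≠ i) hτ = 1 := by
    ext i
    simpa using (h i).resolve_left i.2
  have h₃ : (σ * τ).subtypePerm (p := fun i => σ i ≠ i) hστ =
      σ.subtypePerm (p := fun i => σ i ≠ i) hσ := by
    ext i
    simp [(h i).resolve_left i.2]
  have h₄ : (σ * τ).subtypePerm (p := fun i => ¬ σ i ≠ i) (fun i => not_congr (hστ i)) =
      τ.subtypePerm (p := fun i => ¬ σ i ≠ i) fun i => not_congr (hτ i) := by
    ext i
    simpa using (not_congr (hτ i)).2 i.2
  rw [h₁, h₂, h₃, h₄, permSum_one M hM, permSum_one M hM, mul_one, one_mul]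

theorem permSum_extendDomain (hM : M.trace = 1) {p : α → Prop} [DecidablePred p]
    (e : β ≃ Subtype p) (τ : Equiv.Perm β) :
    permSum M (τ.extendDomain e) = permSum M τ := by
  have hp : ∀ i, p (τ.extendDomain e i) ↔ p i := fun i => by
    by_cases hi : p i
    · simpa [Equiv.Perm.extendDomain_apply_subtype _ e hi, hi] using (e _).2
    · rw [Equiv.Perm.extendDomain_apply_not_subtype _ e hi]
  have h₁ : (τ.extendDomain e).subtypePerm (p := fun i => ¬ p i) (fun i => not_congr (hp i)) =
      1 := by
    ext i
    simpa using Equiv.Perm.extendDomain_apply_not_subtype τ e i.2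
  rw [permSum_eq_mul_subtypePerm M p _ hp, h₁, permSum_one M hM, mul_one]
  exact (permSum_congr M e _ _ fun i => Subtype.ext (by simp)).symm

variable [DecidableEq ι]

theorem pow_succ_apply_eq_sum_prod (k : ℕ) (a b : ι) :
    (M ^ (k + 1)) b a = ∑ x : Fin k → ι,
      ∏ i, M (Fin.snoc (α := fun _ => ι) x b i) (Fin.cons (α := fun _ => ι) a x i) := by
  induction k generalizing a with
  | zero => simp [Fin.snoc]
  | succ k ih =>
    rw [pow_succ, Matrix.mul_apply, ← (Fin.consEquiv fun _ => ι).sum_comp,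
      Fintype.sum_prod_type]
    refine Finset.sum_congr rfl fun c _ => ?_
    rw [ih, Finset.sum_mul]
    refine Finset.sum_congr rfl fun x _ => ?_
    rw [Fin.prod_univ_succ (n := k + 1), mul_comm]
    simp [Fin.consEquiv, ← Fin.cons_snoc_eq_snoc_cons]

theorem permSum_finRotate (k : ℕ) : permSum M (finRotate (k + 1)) = (M ^ (k + 1)).trace := by
  rw [permSum, ← (Fin.consEquiv fun _ => ι).sum_comp, Fintype.sum_prod_type, Matrix.trace]
  refine Finset.sum_congr rfl fun a _ => ?_
  rw [Matrix.diag_apply, pow_succ_apply_eq_sum_prod]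
  simp [Fin.consEquiv, Fin.snoc_eq_cons_rotate]

theorem permSum_of_isCycle (hM : M.trace = 1) {σ : Equiv.Perm α} (hσ : σ.IsCycle) :
    permSum M σ = (M ^ σ.support.card).trace := by
  obtain ⟨k, hk⟩ := Nat.exists_eq_add_of_le' hσ.two_le_card_support
  have e : Fin (k + 2) ≃ {i // i ∈ σ.support} :=
    Fintype.equivOfCardEq (by simp [-Equiv.Perm.mem_support, hk])
  have hconj : IsConj σ ((finRotate (k + 2)).extendDomain e) := by
    rw [Equiv.Perm.isConj_iff_cycleType_eq, Equiv.Perm.cycleType_extendDomain, cycleType_finRotate,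
      hσ.cycleType, hk]
  rw [permSum_eq_of_isConj M hconj, permSum_extendDomain M hM, permSum_finRotate, hk]

theorem permSum_eq_prod_cycleType (hM : M.trace = 1) (π : Equiv.Perm α) :
    permSum M π = (π.cycleType.map fun k => (M ^ k).trace).prod := by
  induction π using Equiv.Perm.cycle_induction_on with
  | base_one => simp [permSum_one M hM]
  | base_cycles σ hσ => simp [hσ.cycleType, permSum_of_isCycle M hM hσ]
  | induction_disjoint σ τ hd _ hσ hτ =>
    rw [permSum_mul_of_disjoint M hM hd, hσ, hτ, hd.cycleType_mul, Multiset.map_add,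
      Multiset.prod_add]

end permSum

theorem trace_tensorPow_mul_permOp (n d : ℕ) (ρ : Matrix (Fin d) (Fin d) ℂ)
    (π : Equiv.Perm (Fin n)) : (tensorPow n d ρ * permOp n d π).trace = permSum ρ π := by
  simp only [Matrix.trace, Matrix.diag_apply, Matrix.mul_apply, tensorPow, permOp, Matrix.of_apply,
    permSum]
  rw [Finset.sum_comm]
  simp

theorem stmt4 (n d : ℕ) (hn : 0 < n)
    (ρ : Matrix (Fin d) (Fin d) ℂ) (hρ : ρ.trace = 1)
    (π : Equiv.Perm (Fin n)) :
    (tensorPow n d ρ * permOp n d π).trace =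
      (π.cycleType.map fun k => (ρ ^ k).trace).prod := by
  rw [trace_tensorPow_mul_permOp, permSum_eq_prod_cycleType ρ hρ]
end

section
/- Let d ≥ 1 and let α ∈ ℝ^d satisfy α_i ≥ 0 for all i and Σ_{i=1}^d α_i = 1. Set Δ_i = α_i − 1/d. Then Σ_{i=1}^d α_i³ − (Σ_{i=1}^d α_i²)² ≤ Σ_{i=1}^d Δ_i². -/
theorem stmt7 (d : ℕ) (hd : 1 ≤ d) (α : Fin d → ℝ)
    (hpos : ∀ i, 0 ≤ α i) (hsum : ∑ i, α i = 1) :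
    (∑ i, α i ^ 3) - (∑ i, α i ^ 2) ^ 2 ≤ ∑ i, (α i - 1 / d) ^ 2 := by
  -- The left side is the variance of `α i` under the weights `α`, so at most the second moment
  -- about any point `c`.
  generalize (1 / d : ℝ) = c
  have hle : ∀ i, α i ≤ 1 := fun i =>
    hsum ▸ Finset.single_le_sum (fun j _ => hpos j) (Finset.mem_univ i)
  have hmoment : ∑ i, α i * (α i - c) ^ 2 = ∑ i, α i ^ 3 - 2 * c * ∑ i, α i ^ 2 + c ^ 2 := by
    calc ∑ i, α i * (α i - c) ^ 2
        = ∑ i, (α i ^ 3 - 2 * c * α i ^ 2 + c ^ 2 * α i) :=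
          Finset.sum_congr rfl fun i _ => by ring
      _ = _ := by
          rw [Finset.sum_add_distrib, Finset.sum_sub_distrib, ← Finset.mul_sum,
            ← Finset.mul_sum, hsum, mul_one]
  calc ∑ i, α i ^ 3 - (∑ i, α i ^ 2) ^ 2 ≤ ∑ i, α i * (α i - c) ^ 2 := by
        rw [hmoment]
        linarith [sq_nonneg (∑ i, α i ^ 2 - c)]
    _ ≤ ∑ i, (α i - c) ^ 2 :=
        Finset.sum_le_sum fun i _ => mul_le_of_le_one_left (sq_nonneg _) (hle i)
end

section
/- Let c = 2/(2 + √2), let 1 ≤ k ≤ d, let δ, ε ≥ 0, let ρ be a density matrix on ℂ^d, and let σ = diag(β₁, …, β_d) be a diagonal density matrix with β₁ + ⋯ + β_k ≥ 1 − δ (the first k diagonal entries sum to at least 1 − δ). If the Hilbert–Schmidt distance satisfies √(tr((ρ − σ)²)) ≤ c·ε/√k, then the trace norm satisfies ‖ρ − σ‖₁ ≤ 2δ + 2ε. -/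
open Matrix
open scoped ComplexOrder

/-- Conjugating a Hermitian matrix by its eigenvector unitary diagonalizes it. -/
lemma Matrix.IsHermitian.conjTranspose_eigenvectorUnitary_mul_mul {n : Type*} [Fintype n]
    [DecidableEq n] {A : Matrix n n ℂ} (hA : A.IsHermitian) :
    (hA.eigenvectorUnitary : Matrix n n ℂ)ᴴ * A * (hA.eigenvectorUnitary : Matrix n n ℂ) =
      diagonal fun i => (hA.eigenvalues i : ℂ) := by
  have h := hA.conjStarAlgAut_star_eigenvectorUnitary
  rw [Unitary.conjStarAlgAut_apply] at h
  simpa [star_eq_conjTranspose, Function.comp_def] using h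

lemma Matrix.sum_normSq_col_eq_one {n : Type*} [Fintype n] [DecidableEq n]
    {W : Matrix n n ℂ} (hW : Wᴴ * W = 1) (j : n) : ∑ i, Complex.normSq (W i j) = 1 := by
  have h := congrFun (congrFun hW j) j
  rw [mul_apply] at h
  have h2 := congrArg Complex.re h
  simpa [Complex.normSq_apply, Complex.mul_re] using h2

/-- Ky Fan bound: a partial trace in any orthonormal basis is at most the sum of the positive
eigenvalues. -/
lemma Matrix.IsHermitian.sum_re_conj_le_sum_pos_eigenvalues {n : Type*} [Fintype n]
    [DecidableEq n] {B : Matrix n n ℂ} (hB : B.IsHermitian) {U : Matrix n n ℂ}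
    (hU : U * Uᴴ = 1) (S : Finset n) :
    ∑ i ∈ S, ((Uᴴ * B * U) i i).re ≤
      ∑ j with 0 < hB.eigenvalues j, hB.eigenvalues j := by
  set V : Matrix n n ℂ := hB.eigenvectorUnitary.1 with hV
  have hVV : V * Vᴴ = 1 := Unitary.mul_star_self_of_mem hB.eigenvectorUnitary.2
  have hVV' : Vᴴ * V = 1 := Unitary.star_mul_self_of_mem hB.eigenvectorUnitary.2
  set W := Uᴴ * V with hW
  have hWW : Wᴴ * W = 1 := by
    rw [hW, conjTranspose_mul, conjTranspose_conjTranspose, Matrix.mul_assoc,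
      ← Matrix.mul_assoc U, hU, Matrix.one_mul, hVV']
  have hdiag : Uᴴ * B * U = W * (diagonal fun i => (hB.eigenvalues i : ℂ)) * Wᴴ := by
    rw [← hB.conjTranspose_eigenvectorUnitary_mul_mul, ← hV, hW, conjTranspose_mul,
      conjTranspose_conjTranspose]
    calc Uᴴ * B * U = Uᴴ * (V * Vᴴ) * B * (V * Vᴴ) * U := by simp [hVV]
      _ = _ := by simp only [Matrix.mul_assoc]
  have hentry (i : n) : ((Uᴴ * B * U) i i).re =
      ∑ j, hB.eigenvalues j * Complex.normSq (W i j) := by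
    rw [hdiag, mul_apply, Complex.re_sum]
    refine Finset.sum_congr rfl fun j _ => ?_
    rw [mul_diagonal, conjTranspose_apply]
    simp [Complex.normSq_apply, Complex.mul_re, Complex.mul_im]
    ring
  simp_rw [hentry]
  rw [Finset.sum_comm, Finset.sum_filter]
  refine Finset.sum_le_sum fun j _ => ?_
  rw [← Finset.mul_sum]
  have h0 : 0 ≤ ∑ i ∈ S, Complex.normSq (W i j) :=
    Finset.sum_nonneg fun i _ => Complex.normSq_nonneg _
  have h1 : ∑ i ∈ S, Complex.normSq (W i j) ≤ 1 := by
    rw [← sum_normSq_col_eq_one hWW j]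
    exact Finset.sum_le_sum_of_subset_of_nonneg (Finset.subset_univ _)
      fun i _ _ => Complex.normSq_nonneg _
  split_ifs with h
  · exact mul_le_of_le_one_right h.le h1
  · exact mul_nonpos_of_nonpos_of_nonneg (not_lt.mp h) h0

lemma Matrix.IsHermitian.sum_re_diag_sq_le {n : Type*} [Fintype n] [DecidableEq n]
    {M : Matrix n n ℂ} (hM : M.IsHermitian) :
    ∑ i, (M i i).re ^ 2 ≤ ((M ^ 2).trace).re := by
  rw [trace, Complex.re_sum]
  refine Finset.sum_le_sum fun i _ => ?_
  rw [diag_apply, pow_two M, mul_apply, Complex.re_sum]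
  have hterm (j : n) : (M i j * M j i).re = Complex.normSq (M i j) := by
    rw [← hM.apply j i]
    simp [Complex.normSq_apply, Complex.mul_re]
  simp_rw [hterm]
  calc (M i i).re ^ 2 ≤ Complex.normSq (M i i) := by
        rw [Complex.normSq_apply]; nlinarith [sq_nonneg (M i i).im]
    _ ≤ _ := Finset.single_le_sum (f := fun j => Complex.normSq (M i j))
        (fun j _ => Complex.normSq_nonneg _) (Finset.mem_univ i)

/-- A partial trace over `m` vectors of an orthonormal basis is at most `√m` times the
Hilbert–Schmidt norm. -/
lemma Matrix.IsHermitian.sum_re_conj_le_sqrt {n : Type*} [Fintype n] [DecidableEq n]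
    {A U : Matrix n n ℂ} (hA : A.IsHermitian) (hU : U * Uᴴ = 1) (S : Finset n) :
    ∑ i ∈ S, ((Uᴴ * A * U) i i).re ≤ √S.card * √((A ^ 2).trace).re := by
  have hM : (Uᴴ * A * U).IsHermitian := isHermitian_conjTranspose_mul_mul U hA
  have htr : ((Uᴴ * A * U) ^ 2).trace = (A ^ 2).trace := by
    have : (Uᴴ * A * U) ^ 2 = Uᴴ * (A ^ 2 * U) := by
      calc (Uᴴ * A * U) ^ 2 = Uᴴ * A * (U * Uᴴ) * A * U := by
            simp only [pow_two, Matrix.mul_assoc]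
        _ = _ := by rw [hU]; simp only [pow_two, Matrix.mul_assoc, Matrix.one_mul]
    rw [this, trace_mul_comm, Matrix.mul_assoc, hU, Matrix.mul_one]
  rw [← Real.sqrt_mul (Nat.cast_nonneg _)]
  refine Real.le_sqrt_of_sq_le (sq_sum_le_card_mul_sum_sq.trans ?_)
  refine mul_le_mul_of_nonneg_left ?_ (Nat.cast_nonneg _)
  rw [← htr]
  exact (Finset.sum_le_sum_of_subset_of_nonneg (Finset.subset_univ _)
    fun i _ _ => sq_nonneg _).trans hM.sum_re_diag_sq_le

/-- Subtracting a positive semidefinite matrix from a diagonal matrix supported on `T` leaves at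
most `#T` positive eigenvalues. -/
lemma Matrix.IsHermitian.card_pos_eigenvalues_le {n : Type*} [Fintype n] [DecidableEq n]
    {ρ : Matrix n n ℂ} (hρ : ρ.PosSemidef) {γ : n → ℂ} {T : Finset n} (hγ : ∀ i ∉ T, γ i = 0)
    (hB : (diagonal γ - ρ).IsHermitian) :
    (Finset.univ.filter fun j => 0 < hB.eigenvalues j).card ≤ T.card := by
  by_contra! hlt
  set J := Finset.univ.filter fun j => 0 < hB.eigenvalues j
  set V : Matrix n n ℂ := hB.eigenvectorUnitary.1 with hV
  let f : (J → ℂ) →ₗ[ℂ] (T → ℂ) := (V.submatrix ((↑) : T → n) ((↑) : J → n)).mulVecLin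
  have hker : LinearMap.ker f ≠ ⊥ := LinearMap.ker_ne_bot_of_finrank_lt (by simpa using hlt)
  obtain ⟨c, hc, hc0⟩ := (Submodule.ne_bot_iff _).mp hker
  let e : n → ℂ := fun j => if h : j ∈ J then c ⟨j, h⟩ else 0
  have heJ (j : J) : e j = c j := by simp [e]
  have hx (t : n) (ht : t ∈ T) : (V *ᵥ e) t = 0 := by
    have h := congrFun (LinearMap.mem_ker.mp hc) ⟨t, ht⟩
    simp only [f, mulVecLin_apply, mulVec, dotProduct, submatrix_apply, Pi.zero_apply] at h
    rw [mulVec, dotProduct, ← h, Finset.univ_eq_attach, ← Finset.sum_subset (Finset.subset_univ J),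
      ← Finset.sum_attach]
    · exact Finset.sum_congr rfl fun j _ => by rw [heJ]
    · intro j _ hj
      simp [e, hj]
  have hle : (star (V *ᵥ e) ⬝ᵥ ((diagonal γ - ρ) *ᵥ (V *ᵥ e))).re ≤ 0 := by
    have h0 : diagonal γ *ᵥ (V *ᵥ e) = 0 := by
      ext i
      rw [mulVec_diagonal]
      by_cases hi : i ∈ T
      · simp [hx i hi]
      · simp [hγ i hi]
    rw [sub_mulVec, h0, zero_sub, dotProduct_neg, Complex.neg_re, neg_nonpos]
    exact (Complex.le_def.mp (hρ.dotProduct_mulVec_nonneg _)).1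
  have heq : star (V *ᵥ e) ⬝ᵥ ((diagonal γ - ρ) *ᵥ (V *ᵥ e)) =
      star e ⬝ᵥ ((diagonal fun i => (hB.eigenvalues i : ℂ)) *ᵥ e) := by
    rw [← hB.conjTranspose_eigenvectorUnitary_mul_mul, star_mulVec, ← dotProduct_mulVec,
      mulVec_mulVec, mulVec_mulVec, hV]
  have hsum : (star e ⬝ᵥ ((diagonal fun i => (hB.eigenvalues i : ℂ)) *ᵥ e)).re =
      ∑ i, hB.eigenvalues i * Complex.normSq (e i) := by
    rw [dotProduct, Complex.re_sum]
    refine Finset.sum_congr rfl fun i _ => ?_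
    rw [mulVec_diagonal]
    simp [Complex.normSq_apply, Complex.mul_re, Complex.mul_im]
    ring
  rw [heq, hsum] at hle
  refine hle.not_gt (Finset.sum_pos' (fun i _ => ?_) ?_)
  · by_cases hi : i ∈ J
    · exact mul_nonneg (Finset.mem_filter.mp hi).2.le (Complex.normSq_nonneg _)
    · simp [e, hi]
  · obtain ⟨j, hj⟩ := Function.ne_iff.mp hc0
    refine ⟨j, Finset.mem_univ _, mul_pos (Finset.mem_filter.mp j.2).2 ?_⟩
    rw [heJ]
    exact Complex.normSq_pos.mpr hj

lemma Matrix.PosSemidef.sum_re_conj_le_trace {n : Type*} [Fintype n] [DecidableEq n]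
    {R U : Matrix n n ℂ} (hR : R.PosSemidef) (hU : U * Uᴴ = 1) (S : Finset n) :
    ∑ i ∈ S, ((Uᴴ * R * U) i i).re ≤ R.trace.re := by
  have htr : R.trace = (Uᴴ * R * U).trace := by
    rw [Matrix.mul_assoc, trace_mul_comm, Matrix.mul_assoc, hU, Matrix.mul_one]
  rw [htr, trace, Complex.re_sum]
  exact Finset.sum_le_sum_of_subset_of_nonneg (Finset.subset_univ _)
    fun i _ _ => (Complex.le_def.mp (hR.conjTranspose_mul_mul_same U).diag_nonneg).1

lemma Finset.sum_abs_eq_two_mul_sum_neg {ι : Type*} [Fintype ι] {a : ι → ℝ} (ha : ∑ i, a i = 0) :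
    ∑ i, |a i| = 2 * ∑ i with a i < 0, -a i := by
  have h : ∑ i, (|a i| + a i * (-1)) = ∑ i, 2 * (if a i < 0 then -a i else 0) := by
    refine Finset.sum_congr rfl fun i _ => ?_
    split_ifs with hi
    · rw [abs_of_neg hi]; ring
    · rw [abs_of_nonneg (not_lt.mp hi)]; ring
  rw [Finset.sum_add_distrib, ← Finset.sum_mul, ha, ← Finset.mul_sum, ← Finset.sum_filter] at h
  linarith

theorem stmt13 (d k : ℕ) (hk1 : 1 ≤ k) (hkd : k ≤ d)
    (δ ε : ℝ) (hδ : 0 ≤ δ) (hε : 0 ≤ ε)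
    (ρ : Matrix (Fin d) (Fin d) ℂ) (hρ : ρ.PosSemidef) (hρtr : ρ.trace = 1)
    (β : Fin d → ℝ) (hβ0 : ∀ i, 0 ≤ β i) (hβsum : ∑ i, β i = 1)
    (htop : 1 - δ ≤ ∑ i ∈ Finset.univ.filter (fun i : Fin d => (i : ℕ) < k), β i)
    (hHS : Real.sqrt ((((ρ - Matrix.diagonal fun i => (β i : ℂ)) ^ 2).trace).re) ≤
      (2 / (2 + Real.sqrt 2)) * ε / Real.sqrt k)
    (hherm : (ρ - Matrix.diagonal fun i => (β i : ℂ)).IsHermitian) :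
    ∑ i, |hherm.eigenvalues i| ≤ 2 * δ + 2 * ε := by
  set T := Finset.univ.filter (fun i : Fin d => (i : ℕ) < k)
  set σ : Matrix (Fin d) (Fin d) ℂ := Matrix.diagonal fun i => (β i : ℂ) with hσ
  let γ : Fin d → ℂ := fun i => if i ∈ T then (β i : ℂ) else 0
  let τ : Fin d → ℂ := fun i => if i ∈ T then 0 else (β i : ℂ)
  have hστ : σ = diagonal γ + diagonal τ := by
    rw [diagonal_add, hσ]
    congr 1
    ext i
    by_cases hi : i ∈ T <;> simp [γ, τ, hi]
  have hτ : (diagonal τ).PosSemidef := PosSemidef.diagonal fun i => by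
    by_cases hi : i ∈ T <;> simp [τ, hi, hβ0 i]
  have hτtr : (diagonal τ).trace.re ≤ δ := by
    have h1 : (diagonal τ).trace.re = ∑ i, if i ∈ T then 0 else β i := by
      rw [trace_diagonal, Complex.re_sum]
      exact Finset.sum_congr rfl fun i _ => by by_cases hi : i ∈ T <;> simp [τ, hi]
    have h2 : (∑ i, if i ∈ T then 0 else β i) + ∑ i ∈ T, β i = 1 := by
      have h3 : ∑ i ∈ T, β i = ∑ i, if i ∈ T then β i else 0 := by simp
      rw [← hβsum, h3, ← Finset.sum_add_distrib]
      exact Finset.sum_congr rfl fun i _ => by by_cases hi : i ∈ T <;> simp [hi]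
    linarith
  have hB : (diagonal γ - ρ).IsHermitian := by
    have : diagonal γ - ρ = -(ρ - σ) - diagonal τ := by rw [hστ]; abel
    rw [this]
    exact hherm.neg.sub hτ.1
  have hTcard : T.card ≤ k := by
    rw [← Finset.card_map Fin.valEmbedding, ← Finset.card_range k]
    refine Finset.card_le_card fun x hx => ?_
    obtain ⟨i, hi, rfl⟩ := Finset.mem_map.mp hx
    exact Finset.mem_range.mpr (Finset.mem_filter.mp hi).2
  set J := Finset.univ.filter fun j => 0 < hB.eigenvalues j
  have hJcard : J.card ≤ k :=
    (IsHermitian.card_pos_eigenvalues_le hρ (fun i hi => by simp [γ, hi]) hB).trans hTcard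
  set V : Matrix (Fin d) (Fin d) ℂ := hB.eigenvectorUnitary.1 with hV
  have hVV : V * Vᴴ = 1 := Unitary.mul_star_self_of_mem hB.eigenvectorUnitary.2
  set U : Matrix (Fin d) (Fin d) ℂ := hherm.eigenvectorUnitary.1 with hU
  have hUU : U * Uᴴ = 1 := Unitary.mul_star_self_of_mem hherm.eigenvectorUnitary.2
  have hpos : ∑ j ∈ J, hB.eigenvalues j ≤ ε := by
    have hkpos : 0 < √(k : ℝ) := Real.sqrt_pos.mpr (by exact_mod_cast hk1)
    have hle : ∑ j ∈ J, hB.eigenvalues j ≤ ∑ j ∈ J, ((Vᴴ * (-(ρ - σ)) * V) j j).re := by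
      refine Finset.sum_le_sum fun j _ => ?_
      have hsplit : -(ρ - σ) = (diagonal γ - ρ) + diagonal τ := by rw [hστ]; abel
      rw [hsplit, Matrix.mul_add, Matrix.add_mul, hV,
        hB.conjTranspose_eigenvectorUnitary_mul_mul, ← hV, Matrix.add_apply, diagonal_apply_eq,
        Complex.add_re, Complex.ofReal_re]
      have := (Complex.le_def.mp ((hτ.conjTranspose_mul_mul_same V).diag_nonneg (i := j))).1
      rw [Complex.zero_re] at this
      linarith
    calc _ ≤ _ := hle
      _ ≤ √J.card * √(((-(ρ - σ)) ^ 2).trace).re := hherm.neg.sum_re_conj_le_sqrt hVV J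
      _ = √J.card * √((ρ - σ) ^ 2).trace.re := by rw [neg_sq]
      _ ≤ √k * ((2 / (2 + √2)) * ε / √k) := by gcongr
      _ = (2 / (2 + √2)) * ε := by field_simp
      _ ≤ ε := mul_le_of_le_one_left hε
        ((div_le_one (by positivity)).mpr (by linarith [Real.sqrt_nonneg 2]))
  have htr : ∑ i, hherm.eigenvalues i = 0 := by
    have h := hherm.trace_eq_sum_eigenvalues
    have hσtr : σ.trace = 1 := by rw [hσ, trace_diagonal, ← Complex.ofReal_sum, hβsum]; rfl
    rw [trace_sub, hρtr, hσtr] at h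
    have h' : ((∑ i, hherm.eigenvalues i : ℝ) : ℂ) = 0 := by simpa using h.symm
    exact_mod_cast h'
  rw [Finset.sum_abs_eq_two_mul_sum_neg htr]
  set I := Finset.univ.filter fun i => hherm.eigenvalues i < 0
  have hneg : ∑ i ∈ I, -hherm.eigenvalues i =
      ∑ i ∈ I, ((Uᴴ * (diagonal γ - ρ) * U) i i).re +
        ∑ i ∈ I, ((Uᴴ * diagonal τ * U) i i).re := by
    rw [← Finset.sum_add_distrib]
    refine Finset.sum_congr rfl fun i _ => ?_
    have hsplit : diagonal γ - ρ + diagonal τ = -(ρ - σ) := by rw [hστ]; abel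
    rw [← Complex.add_re, ← Matrix.add_apply, ← Matrix.add_mul, ← Matrix.mul_add, hsplit,
      Matrix.mul_neg, Matrix.neg_mul, hU, hherm.conjTranspose_eigenvectorUnitary_mul_mul]
    simp
  have h1 := hB.sum_re_conj_le_sum_pos_eigenvalues hUU I
  have h2 := hτ.sum_re_conj_le_trace hUU I
  linarith
end

section
/- Let σ = diag(β₁, …, β_d) with β_i > 0 for all i and Σ_i β_i = 1, let ρ be a density matrix on ℂ^d with the same dimension, and set Δ = ρ − σ. Write m(i,j) = (β_i + β_j)/2, define the trilinear form T(R, S, T') = Σ_{i,j,k} T'_{ij}·S_{jk}·R_{ki} / (m(i,j)·m(i,k)) and the bilinear form B(S, T') = Σ_{i,j} T'_{ij}·S_{ji} / m(i,j), and let D = B(Δ, Δ). Then T(ρ, ρ, ρ) − B(ρ, ρ)² = T(Δ, Δ, Δ) + T(Δ, σ, Δ) − D². -/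
open Matrix
open scoped ComplexOrder

/-- `m(i,j) = (β i + β j)/2`, as a complex number. -/
noncomputable def mhalf {d : ℕ} (β : Fin d → ℝ) (i j : Fin d) : ℂ :=
  (((β i + β j) / 2 : ℝ) : ℂ)

/-- The trilinear form `T(R,S,T') = Σ_{i,j,k} T'_{ij} S_{jk} R_{ki} / (m(i,j) m(i,k))`. -/
noncomputable def Tform {d : ℕ} (β : Fin d → ℝ) (R S T' : Matrix (Fin d) (Fin d) ℂ) : ℂ :=
  ∑ i, ∑ j, ∑ k, T' i j * S j k * R k i / (mhalf β i j * mhalf β i k)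

/-- The bilinear form `B(S,T') = Σ_{i,j} T'_{ij} S_{ji} / m(i,j)`. -/
noncomputable def Bform {d : ℕ} (β : Fin d → ℝ) (S T' : Matrix (Fin d) (Fin d) ℂ) : ℂ :=
  ∑ i, ∑ j, T' i j * S j i / mhalf β i j

theorem mhalf_self {d : ℕ} (β : Fin d → ℝ) (i : Fin d) : mhalf β i i = (β i : ℂ) := by
  simp [mhalf]

theorem Tform_add_left {d : ℕ} (β : Fin d → ℝ) (R R' S T : Matrix (Fin d) (Fin d) ℂ) :
    Tform β (R + R') S T = Tform β R S T + Tform β R' S T := by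
  simp only [Tform, Matrix.add_apply, mul_add, add_div, Finset.sum_add_distrib]

theorem Tform_add_middle {d : ℕ} (β : Fin d → ℝ) (R S S' T : Matrix (Fin d) (Fin d) ℂ) :
    Tform β R (S + S') T = Tform β R S T + Tform β R S' T := by
  simp only [Tform, Matrix.add_apply, mul_add, add_mul, add_div, Finset.sum_add_distrib]

theorem Tform_add_right {d : ℕ} (β : Fin d → ℝ) (R S T T' : Matrix (Fin d) (Fin d) ℂ) :
    Tform β R S (T + T') = Tform β R S T + Tform β R S T' := by
  simp only [Tform, Matrix.add_apply, add_mul, add_div, Finset.sum_add_distrib]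

theorem Bform_add_left {d : ℕ} (β : Fin d → ℝ) (S S' T : Matrix (Fin d) (Fin d) ℂ) :
    Bform β (S + S') T = Bform β S T + Bform β S' T := by
  simp only [Bform, Matrix.add_apply, mul_add, add_div, Finset.sum_add_distrib]

theorem Bform_add_right {d : ℕ} (β : Fin d → ℝ) (S T T' : Matrix (Fin d) (Fin d) ℂ) :
    Bform β S (T + T') = Bform β S T + Bform β S T' := by
  simp only [Bform, Matrix.add_apply, add_mul, add_div, Finset.sum_add_distrib]

theorem Bform_diagonal_left {d : ℕ} (β : Fin d → ℝ) (hβ : ∀ i, β i ≠ 0)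
    (T : Matrix (Fin d) (Fin d) ℂ) :
    Bform β (diagonal fun i => (β i : ℂ)) T = T.trace := by
  refine Finset.sum_congr rfl fun i _ => ?_
  rw [Finset.sum_eq_single i (fun j _ hj => by simp [hj]) (by simp)]
  have h : (β i : ℂ) ≠ 0 := by exact_mod_cast hβ i
  simp [mhalf_self, h]

theorem Bform_diagonal_right {d : ℕ} (β : Fin d → ℝ) (hβ : ∀ i, β i ≠ 0)
    (S : Matrix (Fin d) (Fin d) ℂ) :
    Bform β S (diagonal fun i => (β i : ℂ)) = S.trace := by
  refine Finset.sum_congr rfl fun i _ => ?_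
  rw [Finset.sum_eq_single i (fun j _ hj => by simp [hj.symm]) (by simp)]
  have h : (β i : ℂ) ≠ 0 := by exact_mod_cast hβ i
  simp [mhalf_self, h]

theorem Tform_diagonal_left {d : ℕ} (β : Fin d → ℝ) (hβ : ∀ i, β i ≠ 0)
    (S T : Matrix (Fin d) (Fin d) ℂ) :
    Tform β (diagonal fun i => (β i : ℂ)) S T = Bform β S T := by
  refine Finset.sum_congr rfl fun i _ => Finset.sum_congr rfl fun j _ => ?_
  rw [Finset.sum_eq_single i (fun k _ hk => by simp [hk]) (by simp)]
  have h : (β i : ℂ) ≠ 0 := by exact_mod_cast hβ i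
  rw [mhalf_self, diagonal_apply_eq, mul_div_mul_right _ _ h]

theorem Tform_diagonal_right {d : ℕ} (β : Fin d → ℝ) (hβ : ∀ i, β i ≠ 0)
    (R S : Matrix (Fin d) (Fin d) ℂ) :
    Tform β R S (diagonal fun i => (β i : ℂ)) = Bform β R S := by
  refine Finset.sum_congr rfl fun i _ => ?_
  rw [Finset.sum_eq_single i (fun j _ hj => by simp [hj.symm]) (by simp)]
  refine Finset.sum_congr rfl fun k _ => ?_
  have h : (β i : ℂ) ≠ 0 := by exact_mod_cast hβ i
  rw [mhalf_self, diagonal_apply_eq, mul_assoc, mul_div_mul_left _ _ h]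

theorem stmt14 (d : ℕ) (β : Fin d → ℝ) (hβ : ∀ i, 0 < β i) (hβsum : ∑ i, β i = 1)
    (ρ : Matrix (Fin d) (Fin d) ℂ) (hρ : ρ.PosSemidef) (hρtr : ρ.trace = 1) :
    Tform β ρ ρ ρ - (Bform β ρ ρ) ^ 2 =
      Tform β (ρ - Matrix.diagonal fun i => (β i : ℂ))
          (ρ - Matrix.diagonal fun i => (β i : ℂ))
          (ρ - Matrix.diagonal fun i => (β i : ℂ)) +
        Tform β (ρ - Matrix.diagonal fun i => (β i : ℂ))
          (Matrix.diagonal fun i => (β i : ℂ))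
          (ρ - Matrix.diagonal fun i => (β i : ℂ)) -
        (Bform β (ρ - Matrix.diagonal fun i => (β i : ℂ))
          (ρ - Matrix.diagonal fun i => (β i : ℂ))) ^ 2 := by
  have hβ' : ∀ i, β i ≠ 0 := fun i => (hβ i).ne'
  have hσ : (diagonal fun i => (β i : ℂ)).trace = 1 := by
    rw [trace_diagonal]
    exact_mod_cast hβsum
  obtain ⟨Δ, rfl⟩ : ∃ Δ, ρ = (diagonal fun i => (β i : ℂ)) + Δ :=
    ⟨ρ - diagonal fun i => (β i : ℂ), by abel⟩
  have hΔ : Δ.trace = 0 := by simpa [trace_add, hσ] using hρtr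
  simp only [add_sub_cancel_left, Tform_add_left, Tform_add_middle, Tform_add_right,
    Bform_add_left, Bform_add_right, Tform_diagonal_left β hβ', Tform_diagonal_right β hβ',
    Bform_diagonal_left β hβ', Bform_diagonal_right β hβ', hρtr, hΔ]
  ring
end
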